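/- arXiv:1207.0187 — 3 statements merged into one kernel-verified Lean document; each statement's English description precedes it below -/
import Mathlib

section
/- (Theorem S3.2, item 2) Suppose the random vectors P_1 and P_2 are independent, with arbitrary dependence among the coordinates within each of P_1 and P_2, and S is a valid selection rule which in addition satisfies S(p) ⊆ {j : p_j ≤ t} for every p, where 0 < t < q_1/(1 + ∑_{i=1}^{m−1} 1/i). Let q̃_1 = max{x > 0 : x(1 + ∑_{i=1}^{⌈tm/x − 1⌉} 1/i) = q_1}. Consider Procedure 3.2 with parameters (q_1, q) modified as follows: in the thresholds r q_1/m and R_2 q_1/m, replace q_1 by q̃_1; and in the thresholds r(q−q_1)/R_1 and R_2(q−q_1)/R_1, replace q−q_1 by (q−q_1)/(∑_{i=1}^{R_1} 1/i). Then the modified procedure satisfies FDR ≤ q for the family of no-replicability nulls H_{NR,1},…,H_{NR,m}. -/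
open MeasureTheory ProbabilityTheory Finset

namespace Replicability

/-- A selection rule `S` is measurable: the preimage of each possible selected set is a
measurable subset of `[0,1]^m` (here all of `ℝ^m`). -/
def MeasRule (m : ℕ) (S : (Fin m → ℝ) → Finset (Fin m)) : Prop :=
  ∀ A : Finset (Fin m), MeasurableSet {p : Fin m → ℝ | S p = A}

/-- A valid selection rule: for any `p`, any `j ∈ S p`, and any `p'` agreeing with `p` in all
coordinates except possibly the `j`-th such that `j` is still selected under `p'`,
the selected set is unchanged. -/
def ValidRule (m : ℕ) (S : (Fin m → ℝ) → Finset (Fin m)) : Prop :=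
  ∀ p p' : Fin m → ℝ, ∀ j ∈ S p, (∀ i, i ≠ j → p' i = p i) → j ∈ S p' → S p' = S p

/-- Null p-values are superuniform: if `h j = false` (hypothesis `j` is a true null in this
study) then `Pr(P_j ≤ x) ≤ x` for all `x ∈ [0,1]`. -/
def Superuniform {Ω : Type*} [MeasurableSpace Ω] (μ : Measure Ω) {m : ℕ}
    (P : Ω → Fin m → ℝ) (h : Fin m → Bool) : Prop :=
  ∀ j : Fin m, h j = false → ∀ x : ℝ, 0 ≤ x → x ≤ 1 →
    μ {ω | P ω j ≤ x} ≤ ENNReal.ofReal x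

/-- p-values take values in `[0,1]`. -/
def InUnit {Ω : Type*} {m : ℕ} (P : Ω → Fin m → ℝ) : Prop :=
  ∀ ω j, P ω j ∈ Set.Icc (0 : ℝ) 1

/-- The (generalized) rejection set of Procedure 3.2: with selected set `𝓡₁ = S p₁` of size
`R₁`, primary thresholds `r * a / m` and follow-up thresholds `r * b R₁ / R₁`, let
`R₂ = max { r ≤ m : #{j ∈ 𝓡₁ : p₁ⱼ ≤ r a/m ∧ p₂ⱼ ≤ r (b R₁)/R₁} = r }`, and reject
`{j ∈ 𝓡₁ : p₁ⱼ ≤ R₂ a/m ∧ p₂ⱼ ≤ R₂ (b R₁)/R₁}`.  The basic Procedure 3.2 with parameters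
`(q₁, q)` is obtained with `a = q₁` and `b = fun _ => q - q₁`. -/
noncomputable def rejSet (m : ℕ) (S : (Fin m → ℝ) → Finset (Fin m))
    (a : ℝ) (b : ℕ → ℝ) (p1 p2 : Fin m → ℝ) : Finset (Fin m) :=
  let R1 := (S p1).card
  let R2 := sSup {r : ℕ | r ≤ m ∧
    ((S p1).filter
      (fun j => p1 j ≤ r * a / m ∧ p2 j ≤ r * b R1 / R1)).card = r}
  (S p1).filter (fun j => p1 j ≤ R2 * a / m ∧ p2 j ≤ R2 * b R1 / R1)

/-- False discovery proportion of rejection set `R` with respect to the set `I` of true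
nulls: `|R ∩ I| / max(|R|, 1)`. -/
noncomputable def FDP {m : ℕ} (I R : Finset (Fin m)) : ℝ :=
  ((R ∩ I).card : ℝ) / ((max R.card 1 : ℕ) : ℝ)

/-- The set `I_{ab} = {j : (h₁ⱼ, h₂ⱼ) = (a, b)}` (with `true` for 1, `false` for 0). -/
def Iset {m : ℕ} (h1 h2 : Fin m → Bool) (a b : Bool) : Finset (Fin m) :=
  Finset.univ.filter fun j => h1 j = a ∧ h2 j = b

/-- The indices of true no-replicability nulls: `I₀₀ ∪ I₀₁ ∪ I₁₀`. -/
def nullNR {m : ℕ} (h1 h2 : Fin m → Bool) : Finset (Fin m) :=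
  Finset.univ.filter fun j => h1 j = false ∨ h2 j = false

/-- Harmonic sum `∑_{i=1}^n 1/i`. -/
noncomputable def Hsum (n : ℕ) : ℝ := ∑ i ∈ Finset.range n, (1 : ℝ) / (i + 1)

/-- PRDS property of a random vector `Q` on a set `T` of coordinates: for every measurable
increasing set `D` and every `i ∈ T`, some monotone measurable `g` is a version of
`p ↦ Pr(Q ∈ D | Q_i = p)`. -/
def PRDS {Ω : Type*} [MeasurableSpace Ω] (μ : Measure Ω) {m : ℕ}
    (Q : Ω → Fin m → ℝ) (T : Set (Fin m)) : Prop :=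
  ∀ D : Set (Fin m → ℝ), MeasurableSet D →
    (∀ x ∈ D, ∀ y : Fin m → ℝ, x ≤ y → y ∈ D) →
    ∀ i ∈ T, ∃ g : ℝ → ℝ, Monotone g ∧ Measurable g ∧
      ∀ B : Set ℝ, MeasurableSet B →
        (μ ({ω | Q ω ∈ D} ∩ {ω | Q ω i ∈ B})).toReal =
          ∫ ω in {ω | Q ω i ∈ B}, g (Q ω i) ∂μ

end Replicability

namespace Replicability

/-- A monotone self-map of `ℕ` bounded by `m` has a fixed point that is at most `m`. -/
theorem exists_fixedPoint_le {f : ℕ → ℕ} (hf : Monotone f) {m : ℕ} (hm : ∀ r, f r ≤ m) :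
    ∃ r ≤ m, f r = r := by
  classical
  have hex : ∃ r, f r ≤ r := ⟨m, hm m⟩
  have hle : f (Nat.find hex) ≤ Nat.find hex := Nat.find_spec hex
  refine ⟨Nat.find hex, Nat.find_min' hex (hm m), hle.antisymm ?_⟩
  rcases hr : Nat.find hex with _ | r
  · exact Nat.zero_le _
  · have hlt : r < f r := not_le.mp (Nat.find_min hex (by omega))
    exact hlt.trans_le (hf r.le_succ)

/-- A rejected index is selected, and its two p-values lie below the thresholds evaluated at
the number of rejections. -/
theorem mem_rejSet {m : ℕ} {S : (Fin m → ℝ) → Finset (Fin m)} {a : ℝ} {b : ℕ → ℝ}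
    {p1 p2 : Fin m → ℝ} (ha : 0 ≤ a) (hb : ∀ n, 0 ≤ b n) {j : Fin m}
    (hj : j ∈ rejSet m S a b p1 p2) :
    j ∈ S p1 ∧ p1 j ≤ (rejSet m S a b p1 p2).card * (a / m) ∧
      p2 j ≤ (rejSet m S a b p1 p2).card * (b (S p1).card / (S p1).card) := by
  set f : ℕ → Finset (Fin m) := fun r => (S p1).filter
    (fun j => p1 j ≤ r * a / m ∧ p2 j ≤ r * b (S p1).card / (S p1).card) with hf
  have hmono : Monotone fun r => (f r).card := by
    intro r s hrs
    refine card_le_card fun j hj => ?_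
    simp only [hf, mem_filter] at hj ⊢
    have hrs' : (r : ℝ) ≤ s := by exact_mod_cast hrs
    refine ⟨hj.1, hj.2.1.trans ?_, hj.2.2.trans ?_⟩
    · gcongr
    · gcongr
      exact hb _
  obtain ⟨r, hrm, hr⟩ := exists_fixedPoint_le hmono
    (fun r => (card_le_univ (f r)).trans_eq (Fintype.card_fin m))
  have hmem : sSup {r : ℕ | r ≤ m ∧ (f r).card = r} ∈ {r : ℕ | r ≤ m ∧ (f r).card = r} :=
    Nat.sSup_mem ⟨r, hrm, hr⟩ ⟨m, fun _ h => h.1⟩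
  have hrej : rejSet m S a b p1 p2 = f (sSup {r : ℕ | r ≤ m ∧ (f r).card = r}) := rfl
  rw [hrej] at hj ⊢
  rw [hmem.2]
  simp only [hf, mem_filter] at hj
  rw [← mul_div_assoc, ← mul_div_assoc]
  exact hj

/-- The step function of `p` which, for `p ≤ (N + 1) * c`, equals the reciprocal of the least
positive integer `n` with `p ≤ n * c`. -/
noncomputable def stepBound (N : ℕ) (c p : ℝ) : ℝ :=
  ∑ k ∈ range N, (if p ≤ (k + 1) * c then (1 : ℝ) / (k + 1) - 1 / (k + 2) else 0) +
    if p ≤ (N + 1) * c then (1 : ℝ) / (N + 1) else 0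

theorem inv_sub_inv_succ_nonneg (k : ℕ) : (0 : ℝ) ≤ 1 / (k + 1) - 1 / (k + 2) :=
  sub_nonneg.mpr (one_div_le_one_div_of_le (by positivity) (by linarith))

theorem stepBound_nonneg (N : ℕ) (c p : ℝ) : 0 ≤ stepBound N c p := by
  refine add_nonneg (sum_nonneg fun k _ => ?_) ?_
  · split_ifs
    · exact inv_sub_inv_succ_nonneg k
    · exact le_rfl
  · split_ifs <;> positivity

theorem one_div_le_stepBound {N n : ℕ} {c p : ℝ} (hc : 0 ≤ c) (hn : 1 ≤ n)
    (hpn : p ≤ n * c) (hpN : p ≤ (N + 1) * c) : (1 : ℝ) / n ≤ stepBound N c p := by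
  induction N with
  | zero =>
    have hn' : (1 : ℝ) ≤ n := by exact_mod_cast hn
    simp only [stepBound, range_zero, sum_empty, zero_add, if_pos hpN]
    simpa using inv_le_one_of_one_le₀ hn'
  | succ N ih =>
    by_cases hp : p ≤ (N + 1) * c
    · refine (ih hp).trans_eq ?_
      simp only [stepBound, sum_range_succ, if_pos hp, if_pos hpN]
      push_cast
      ring
    · have hlt : N + 1 < n := by
        by_contra! h
        have h' : (n : ℝ) ≤ N + 1 := by exact_mod_cast h
        exact hp (hpn.trans (mul_le_mul_of_nonneg_right h' hc))
      have hlt' : ((N + 1 : ℕ) : ℝ) + 1 ≤ n := by exact_mod_cast hlt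
      refine (one_div_le_one_div_of_le (by positivity) hlt').trans ?_
      rw [stepBound, if_pos hpN]
      refine le_add_of_nonneg_left (sum_nonneg fun k _ => ?_)
      split_ifs
      · exact inv_sub_inv_succ_nonneg k
      · exact le_rfl

theorem sum_mul_inv_sub_inv_succ (N : ℕ) (c : ℝ) :
    ∑ k ∈ range N, ((k + 1) * c * ((1 : ℝ) / (k + 1) - 1 / (k + 2))) +
      (N + 1) * c * ((1 : ℝ) / (N + 1)) = c * Hsum (N + 1) := by
  have hN : ((N : ℝ) + 1) * c * (1 / (N + 1)) = c := by field_simp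
  rw [hN, Hsum, sum_range_succ', mul_add, mul_sum]
  congr 1
  · refine sum_congr rfl fun k _ => ?_
    push_cast
    field_simp
    ring
  · simp

section Expectation

variable {Ω : Type*} [MeasurableSpace Ω] {μ : Measure Ω} {X : Ω → ℝ}

theorem integrable_ite_le [IsFiniteMeasure μ] (hX : Measurable X) (x w : ℝ) :
    Integrable (fun ω => if X ω ≤ x then w else 0) μ :=
  (integrable_const w).indicator (measurableSet_le hX measurable_const)

theorem integral_ite_le (hX : Measurable X) (x w : ℝ) :
    ∫ ω, (if X ω ≤ x then w else 0) ∂μ = μ.real {ω | X ω ≤ x} * w := by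
  have h := integral_indicator_const (μ := μ) w (measurableSet_le hX (measurable_const (a := x)))
  simpa [Set.indicator_apply] using h

theorem integrable_stepBound [IsFiniteMeasure μ] (hX : Measurable X) (N : ℕ) (c : ℝ) :
    Integrable (fun ω => stepBound N c (X ω)) μ :=
  (integrable_finsetSum _ fun _ _ => integrable_ite_le hX _ _).add (integrable_ite_le hX _ _)

/-- If `X` is superuniform up to the factor `s`, then the step function has expectation at most
`s * c` times a harmonic number. -/
theorem integral_stepBound_le [IsFiniteMeasure μ] (hX : Measurable X) {s : ℝ}
    (hs : ∀ x, 0 ≤ x → μ.real {ω | X ω ≤ x} ≤ s * x) (N : ℕ) {c : ℝ} (hc : 0 ≤ c) :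
    ∫ ω, stepBound N c (X ω) ∂μ ≤ s * (c * Hsum (N + 1)) := by
  simp only [stepBound]
  rw [integral_add (integrable_finsetSum _ fun _ _ => integrable_ite_le hX _ _)
    (integrable_ite_le hX _ _), integral_finsetSum _ fun _ _ => integrable_ite_le hX _ _,
    ← sum_mul_inv_sub_inv_succ, mul_add, mul_sum]
  refine add_le_add (sum_le_sum fun k _ => ?_) ?_
  · rw [integral_ite_le hX, ← mul_assoc]
    exact mul_le_mul_of_nonneg_right (hs _ (by positivity)) (inv_sub_inv_succ_nonneg k)
  · rw [integral_ite_le hX, ← mul_assoc]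
    exact mul_le_mul_of_nonneg_right (hs _ (by positivity)) (by positivity)

end Expectation

theorem Hsum_nonneg (n : ℕ) : 0 ≤ Hsum n := sum_nonneg fun i _ => by positivity

theorem Hsum_pos {n : ℕ} (hn : 0 < n) : 0 < Hsum n :=
  sum_pos (fun i _ => by positivity) (nonempty_range_iff.mpr hn.ne')

theorem Hsum_succ_le (n : ℕ) : Hsum (n + 1) ≤ 1 + Hsum n := by
  rw [Hsum, sum_range_succ, add_comm, ← Hsum]
  gcongr
  exact div_le_one_of_le₀ (by linarith [n.cast_nonneg (α := ℝ)]) (by positivity)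

theorem Superuniform.measureReal_le {Ω : Type*} [MeasurableSpace Ω] {μ : Measure Ω}
    [IsProbabilityMeasure μ] {m : ℕ} {P : Ω → Fin m → ℝ} {h : Fin m → Bool}
    (hsup : Superuniform μ P h) {j : Fin m} (hj : h j = false) {x : ℝ} (hx : 0 ≤ x) :
    μ.real {ω | P ω j ≤ x} ≤ x := by
  rcases le_total x 1 with hx1 | hx1
  · exact ENNReal.toReal_le_of_le_ofReal hx (hsup j hj x hx hx1)
  · exact measureReal_le_one.trans hx1

/-- Pointwise bound of the false discovery proportion: each false rejection is charged to the
study in which the hypothesis is null. -/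
theorem FDP_le {m : ℕ} {h1 h2 : Fin m → Bool} {R : Finset (Fin m)} {u v : Fin m → ℝ}
    (hu : ∀ j, 0 ≤ u j) (hv : ∀ j, 0 ≤ v j) {A : Finset (Fin m)} (hRA : R ⊆ A)
    (hRu : ∀ j ∈ R, (1 : ℝ) / R.card ≤ u j) (hRv : ∀ j ∈ R, (1 : ℝ) / R.card ≤ v j) :
    FDP (nullNR h1 h2) R ≤
      ∑ j with h1 j = false, u j + ∑ j ∈ A with h2 j = false, v j := by
  have hsplit : R ∩ nullNR h1 h2 =
      {j ∈ R | h1 j = false} ∪ {j ∈ R | h2 j = false} := by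
    ext j
    simp [nullNR, and_or_left]
  have hcard : FDP (nullNR h1 h2) R ≤ ((R ∩ nullNR h1 h2).card : ℝ) * (1 / R.card) := by
    rcases R.eq_empty_or_nonempty with rfl | hR
    · simp [FDP]
    · rw [FDP, max_eq_left hR.card_pos, mul_one_div]
  calc FDP (nullNR h1 h2) R
      ≤ ((R ∩ nullNR h1 h2).card : ℝ) * (1 / R.card) := hcard
    _ ≤ (({j ∈ R | h1 j = false}.card + {j ∈ R | h2 j = false}.card : ℕ) : ℝ) *
        (1 / R.card) := by
        rw [hsplit]
        gcongr
        exact card_union_le _ _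
    _ = ∑ j ∈ R with h1 j = false, (1 : ℝ) / R.card +
        ∑ j ∈ R with h2 j = false, (1 : ℝ) / R.card := by
        simp only [sum_const, nsmul_eq_mul]
        push_cast
        ring
    _ ≤ ∑ j ∈ R with h1 j = false, u j + ∑ j ∈ R with h2 j = false, v j :=
        add_le_add (sum_le_sum fun j hj => hRu j (mem_filter.mp hj).1)
          (sum_le_sum fun j hj => hRv j (mem_filter.mp hj).1)
    _ ≤ ∑ j with h1 j = false, u j + ∑ j ∈ A with h2 j = false, v j :=
        add_le_add
          (sum_le_sum_of_subset_of_nonneg (filter_subset_filter _ (subset_univ R))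
            fun j _ _ => hu j)
          (sum_le_sum_of_subset_of_nonneg (filter_subset_filter _ hRA) fun j _ _ => hv j)

/-- Theorem S3.2, item 2: with arbitrary dependence within each study (the
two studies independent) and a valid selection rule selecting only hypotheses with primary
p-values at most `t < q₁/(1 + ∑_{i=1}^{m-1} 1/i)`, Procedure 3.2 modified by replacing `q₁`
with `q̃₁ = max{x > 0 : x (1 + ∑_{i=1}^{⌈tm/x - 1⌉} 1/i) = q₁}` in the primary thresholds and
`q - q₁` with `(q - q₁)/(∑_{i=1}^{R₁} 1/i)` in the follow-up thresholds controls the FDR at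
level `q`. -/
theorem theorem_S32_item2 {Ω : Type*} [MeasurableSpace Ω]
    (μ : Measure Ω) [IsProbabilityMeasure μ]
    (m : ℕ) (hm : 1 ≤ m)
    (P1 P2 : Ω → Fin m → ℝ) (hP1 : Measurable P1) (hP2 : Measurable P2)
    (hP1u : InUnit P1) (hP2u : InUnit P2)
    (h1 h2 : Fin m → Bool)
    (hsup1 : Superuniform μ P1 h1) (hsup2 : Superuniform μ P2 h2)
    (hIndep : IndepFun P1 P2 μ)
    (S : (Fin m → ℝ) → Finset (Fin m)) (hS : MeasRule m S) (hval : ValidRule m S)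
    (q1 q : ℝ) (hq1 : 0 < q1) (hq1q : q1 < q) (hq : q < 1)
    (t : ℝ) (ht0 : 0 < t) (ht : t < q1 / (1 + Hsum (m - 1)))
    (hSelThr : ∀ p : Fin m → ℝ, ∀ j ∈ S p, p j ≤ t)
    (qt : ℝ)
    (hqt : IsGreatest {x : ℝ | 0 < x ∧ x * (1 + Hsum ⌈t * m / x - 1⌉₊) = q1} qt) :
    ∫ ω, FDP (nullNR h1 h2)
        (rejSet m S qt (fun R1 => (q - q1) / Hsum R1) (P1 ω) (P2 ω)) ∂μ ≤ q := by
  have hqt0 : 0 < qt := hqt.1.1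
  have hqteq : qt * (1 + Hsum ⌈t * m / qt - 1⌉₊) = q1 := hqt.1.2
  have hm0 : (0 : ℝ) < m := by exact_mod_cast hm
  have hb : ∀ n, 0 ≤ (q - q1) / Hsum n := fun n => div_nonneg (by linarith) (Hsum_nonneg n)
  have hP1j : ∀ j, Measurable fun ω => P1 ω j := fun j => (measurable_pi_apply j).comp hP1
  have hP2j : ∀ j, Measurable fun ω => P2 ω j := fun j => (measurable_pi_apply j).comp hP2
  set N := ⌈t * m / qt - 1⌉₊
  set a := qt / m with ha
  have ha0 : 0 ≤ a := by positivity
  have hta : t ≤ (N + 1) * a := by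
    have h : t * m / qt ≤ N + 1 := by linarith [Nat.le_ceil (t * m / qt - 1)]
    rw [div_le_iff₀ hqt0] at h
    rw [ha, ← mul_div_assoc, le_div_iff₀ hm0]
    exact h
  let c : Finset (Fin m) → ℝ := fun A => (q - q1) / Hsum A.card / A.card
  have hc0 : ∀ A, 0 ≤ c A := fun A => div_nonneg (hb _) (Nat.cast_nonneg _)
  let E : Finset (Fin m) → Set Ω := fun A => {ω | S (P1 ω) = A}
  have hE : ∀ A, MeasurableSet (E A) := fun A => hP1 (hS A)
  let U : Ω → ℝ := fun ω => ∑ j with h1 j = false, stepBound N a (P1 ω j)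
  let V : Finset (Fin m) → Ω → ℝ := fun A ω =>
    ∑ j ∈ A with h2 j = false, stepBound (A.card - 1) (c A) (P2 ω j)
  have hUint : Integrable U μ := integrable_finsetSum _ fun j _ =>
    integrable_stepBound (hP1j j) N a
  have hVint : ∀ A ∈ (univ : Finset (Finset (Fin m))), Integrable ((E A).indicator (V A)) μ :=
    fun A _ => Integrable.indicator
      (integrable_finsetSum _ fun j _ => integrable_stepBound (hP2j j) _ _) (hE A)
  have hpoint : ∀ ω, FDP (nullNR h1 h2)
      (rejSet m S qt (fun R1 => (q - q1) / Hsum R1) (P1 ω) (P2 ω)) ≤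
      U ω + ∑ A, (E A).indicator (V A) ω := by
    intro ω
    have hsum : ∑ A, (E A).indicator (V A) ω = V (S (P1 ω)) ω := by
      rw [Finset.sum_eq_single (S (P1 ω))]
      · exact Set.indicator_of_mem (s := E (S (P1 ω))) rfl _
      · exact fun A _ hA => Set.indicator_of_notMem (s := E A) (fun h => hA (Eq.symm h)) _
      · exact fun h => absurd (mem_univ _) h
    rw [hsum]
    have hsub : rejSet m S qt (fun R1 => (q - q1) / Hsum R1) (P1 ω) (P2 ω) ⊆ S (P1 ω) :=
      filter_subset _ _
    refine FDP_le (fun j => stepBound_nonneg _ _ _) (fun j => stepBound_nonneg _ _ _)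
      hsub (fun j hj => ?_) (fun j hj => ?_)
    · obtain ⟨hjS, hj1, -⟩ := mem_rejSet hqt0.le hb hj
      exact one_div_le_stepBound ha0 (card_pos.mpr ⟨j, hj⟩) hj1 ((hSelThr _ j hjS).trans hta)
    · obtain ⟨hjS, -, hj2⟩ := mem_rejSet hqt0.le hb hj
      refine one_div_le_stepBound (hc0 _) (card_pos.mpr ⟨j, hj⟩) hj2 (hj2.trans ?_)
      refine mul_le_mul_of_nonneg_right ?_ (hc0 (S (P1 ω)))
      have hle := card_le_card hsub
      have hpos : 0 < (S (P1 ω)).card := card_pos.mpr ⟨j, hjS⟩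
      exact_mod_cast (show _ ≤ (S (P1 ω)).card - 1 + 1 by omega)
  have hU : ∫ ω, U ω ∂μ ≤ q1 := by
    rw [integral_finsetSum _ fun j _ => integrable_stepBound (hP1j j) N a]
    calc ∑ j with h1 j = false, ∫ ω, stepBound N a (P1 ω j) ∂μ
        ≤ ∑ j : Fin m with h1 j = false, a * Hsum (N + 1) := sum_le_sum fun j hj => by
          have h := integral_stepBound_le (μ := μ) (hP1j j) (s := 1) (fun x hx => by
            simpa using hsup1.measureReal_le (mem_filter.mp hj).2 hx) N ha0
          simpa using h
      _ ≤ m * (a * Hsum (N + 1)) := by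
          rw [sum_const, nsmul_eq_mul]
          refine mul_le_mul_of_nonneg_right ?_ (mul_nonneg ha0 (Hsum_nonneg _))
          exact_mod_cast (card_filter_le _ _).trans_eq (card_fin m)
      _ = qt * Hsum (N + 1) := by rw [ha]; field_simp
      _ ≤ qt * (1 + Hsum N) := mul_le_mul_of_nonneg_left (Hsum_succ_le N) hqt0.le
      _ = q1 := hqteq
  have hV : ∀ A, ∫ ω, (E A).indicator (V A) ω ∂μ ≤ μ.real (E A) * (q - q1) := by
    intro A
    rcases A.eq_empty_or_nonempty with rfl | hA
    · have h : 0 ≤ μ.real (E ∅) * (q - q1) := mul_nonneg measureReal_nonneg (by linarith)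
      simpa [V] using h
    have hApos : 0 < A.card := hA.card_pos
    have hH : 0 < Hsum A.card := Hsum_pos hApos
    have hA0 : (0 : ℝ) < A.card := by exact_mod_cast hApos
    rw [integral_indicator (hE A), integral_finsetSum _ fun j _ =>
      integrable_stepBound (hP2j j) _ _]
    calc ∑ j ∈ A with h2 j = false, ∫ ω in E A, stepBound (A.card - 1) (c A) (P2 ω j) ∂μ
        ≤ ∑ j ∈ A with h2 j = false, μ.real (E A) * (c A * Hsum A.card) :=
          sum_le_sum fun j hj => by
          have h := integral_stepBound_le (μ := μ.restrict (E A)) (hP2j j) (s := μ.real (E A))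
            (fun x hx => by
              have hind := hIndep.measure_inter_preimage_eq_mul {p | S p = A} {p | p j ≤ x}
                (hS A) (measurableSet_le (measurable_pi_apply j) measurable_const)
              rw [measureReal_restrict_apply (measurableSet_le (hP2j j) measurable_const),
                Set.inter_comm]
              calc μ.real (E A ∩ {ω | P2 ω j ≤ x})
                  = μ.real (E A) * μ.real {ω | P2 ω j ≤ x} := by
                    rw [measureReal_def, measureReal_def, measureReal_def, ← ENNReal.toReal_mul]
                    exact congrArg ENNReal.toReal hind
                _ ≤ μ.real (E A) * x := mul_le_mul_of_nonneg_left
                    (hsup2.measureReal_le (mem_filter.mp hj).2 hx) measureReal_nonneg)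
            (A.card - 1) (hc0 A)
          rwa [Nat.sub_add_cancel hApos] at h
      _ ≤ A.card * (μ.real (E A) * (c A * Hsum A.card)) := by
          rw [sum_const, nsmul_eq_mul]
          refine mul_le_mul_of_nonneg_right ?_
            (mul_nonneg measureReal_nonneg (mul_nonneg (hc0 A) hH.le))
          exact_mod_cast card_filter_le _ _
      _ = μ.real (E A) * (q - q1) := by
          simp only [c]
          field_simp
  have hEsum : ∑ A, μ.real (E A) ≤ 1 := by
    have hdisj : Set.PairwiseDisjoint (univ : Finset (Finset (Fin m))) E :=
      fun A _ B _ hAB => Set.disjoint_left.mpr fun ω hωA hωB => hAB (Eq.trans (Eq.symm hωA) hωB)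
    rw [← measureReal_biUnion_finset hdisj fun A _ => hE A]
    exact measureReal_le_one
  calc ∫ ω, FDP (nullNR h1 h2)
        (rejSet m S qt (fun R1 => (q - q1) / Hsum R1) (P1 ω) (P2 ω)) ∂μ
      ≤ ∫ ω, (U ω + ∑ A, (E A).indicator (V A) ω) ∂μ :=
        integral_mono_of_nonneg (Filter.Eventually.of_forall fun ω =>
          div_nonneg (Nat.cast_nonneg _) (Nat.cast_nonneg _))
          (hUint.add (integrable_finsetSum _ hVint)) (Filter.Eventually.of_forall hpoint)
    _ = ∫ ω, U ω ∂μ + ∑ A, ∫ ω, (E A).indicator (V A) ω ∂μ := by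
        rw [integral_add hUint (integrable_finsetSum _ hVint), integral_finsetSum _ hVint]
    _ ≤ q1 + ∑ A, μ.real (E A) * (q - q1) := add_le_add hU (sum_le_sum fun A _ => hV A)
    _ ≤ q1 + 1 * (q - q1) := by
        rw [← sum_mul]
        gcongr
    _ = q := by ring

end Replicability
end

section
/- (Theorem S3.3, item 1) Suppose the random vectors P_1 and P_2 are independent, P_1 is PRDS on {j : h_{1j} = 0}, and P_2 is PRDS on {j : h_{2j} = 0} (arbitrary such dependence within each study). Consider Procedure 4.1 with parameters (w_1, q_1, q) in which the selection rules are the Bonferroni rules S_{12}(p) = {j : p_j ≤ w_1 q_1/m} and S_{21}(p) = {j : p_j ≤ (1−w_1) q_1/m}. Then the rejection set 𝓡_{12} ∪ 𝓡_{21} satisfies FDR ≤ q for the family of no-replicability nulls H_{NR,1},…,H_{NR,m}. -/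
open MeasureTheory ProbabilityTheory Finset

namespace Replicability

lemma natCast_mul_div_le (n : ℕ) {x : ℝ} (hx : 0 ≤ x) : n * (x / n) ≤ x := by
  rcases n.eq_zero_or_pos with rfl | hn
  · simpa using hx
  · exact (mul_div_cancel₀ x (by positivity)).le

/-- The largest fixed point of a monotone self-map of `{0, …, m}` is its largest post-fixed
point. -/
lemma isGreatest_fixed_findGreatest {m : ℕ} {f : ℕ → ℕ} (hf : Monotone f) (hm : ∀ r, f r ≤ m) :
    IsGreatest {r | r ≤ m ∧ f r = r} (Nat.findGreatest (fun r => r ≤ f r) m) := by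
  set N := Nat.findGreatest (fun r => r ≤ f r) m with hN
  have h0 : N ≤ f N := Nat.findGreatest_spec (P := fun r => r ≤ f r) (Nat.zero_le m) (Nat.zero_le _)
  exact ⟨⟨Nat.findGreatest_le m, le_antisymm (Nat.le_findGreatest (hm N) (hf h0)) h0⟩,
    fun r hr => Nat.le_findGreatest hr.1 hr.2.ge⟩

/-- The number of Benjamini–Hochberg rejections among the hypotheses in `A`, where `r` rejections
are made with threshold `r * c`. -/
noncomputable def bhCount {m : ℕ} (A : Finset (Fin m)) (c : ℝ) (p : Fin m → ℝ) : ℕ :=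
  Nat.findGreatest (fun r => r ≤ #{j ∈ A | p j ≤ r * c}) m

lemma bhCount_le {m : ℕ} (A : Finset (Fin m)) (c : ℝ) (p : Fin m → ℝ) : bhCount A c p ≤ m :=
  Nat.findGreatest_le m

lemma measurable_bhCount {m : ℕ} (A : Finset (Fin m)) (c : ℝ) : Measurable (bhCount A c) := by
  refine measurable_findGreatest fun k _ => ?_
  have hcard : Measurable fun p : Fin m → ℝ => #{j ∈ A | p j ≤ k * c} := by
    simp only [card_filter]
    exact Finset.measurable_sum _ fun j _ => Measurable.ite
      (measurableSet_le (measurable_pi_apply j) measurable_const) measurable_const measurable_const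
  exact hcard measurableSet_Ici

lemma antitone_bhCount {m : ℕ} (A : Finset (Fin m)) (c : ℝ) : Antitone (bhCount A c) := by
  intro p p' hp
  refine Nat.findGreatest_mono (fun r hr => hr.trans (card_le_card ?_)) le_rfl
  exact monotone_filter_right A fun j _ hj => (hp j).trans hj

/-- The contribution of hypothesis `j` to the false discovery proportion of the
Benjamini–Hochberg procedure on `A`. -/
noncomputable def bhTerm {m : ℕ} (A : Finset (Fin m)) (c : ℝ) (j : Fin m) (p : Fin m → ℝ) : ℝ :=
  {p : Fin m → ℝ | p j ≤ bhCount A c p * c}.indicator (fun p => (bhCount A c p : ℝ)⁻¹) p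

lemma bhTerm_nonneg {m : ℕ} (A : Finset (Fin m)) (c : ℝ) (j : Fin m) (p : Fin m → ℝ) :
    0 ≤ bhTerm A c j p :=
  Set.indicator_nonneg (fun _ _ => by positivity) p

lemma bhTerm_le_one {m : ℕ} (A : Finset (Fin m)) (c : ℝ) (j : Fin m) (p : Fin m → ℝ) :
    bhTerm A c j p ≤ 1 :=
  Set.indicator_apply_le' (fun _ => Nat.cast_inv_le_one _) fun _ => zero_le_one

lemma measurable_bhTerm {m : ℕ} (A : Finset (Fin m)) (c : ℝ) (j : Fin m) :
    Measurable (bhTerm A c j) := by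
  have hN : Measurable fun p : Fin m → ℝ => (bhCount A c p : ℝ) :=
    measurable_from_nat.comp (measurable_bhCount A c)
  exact hN.inv.indicator (measurableSet_le (measurable_pi_apply j) (hN.mul_const c))

lemma bhTerm_eq_sum {m : ℕ} (A : Finset (Fin m)) (c : ℝ) (j : Fin m) (p : Fin m → ℝ) :
    bhTerm A c j p = ∑ r ∈ range m, {p : Fin m → ℝ | bhCount A c p = r + 1 ∧
      p j ≤ ((r + 1 : ℕ) : ℝ) * c}.indicator (fun _ => ((r + 1 : ℕ) : ℝ)⁻¹) p := by
  rcases hN : bhCount A c p with _ | n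
  · simp [bhTerm, Set.indicator_apply, hN]
  · have hn : n ∈ range m := mem_range.2 (by have := bhCount_le A c p; omega)
    rw [sum_eq_single_of_mem n hn]
    · simp [bhTerm, Set.indicator_apply, hN]
    · intro r _ hr
      exact Set.indicator_of_notMem (fun h => hr (by have := h.1; omega)) _

section Probability

variable {Ω : Type*} [MeasurableSpace Ω] {μ : Measure Ω} [IsProbabilityMeasure μ] {m : ℕ}
  {Q : Ω → Fin m → ℝ}

lemma Superuniform.real_le {h : Fin m → Bool} (hsup : Superuniform μ Q h) {j : Fin m}
    (hj : h j = false) {x : ℝ} (hx : 0 ≤ x) : μ.real {ω | Q ω j ≤ x} ≤ x := by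
  rcases le_total x 1 with hx1 | hx1
  · exact ENNReal.toReal_le_of_le_ofReal hx (hsup j hj x hx hx1)
  · exact measureReal_le_one.trans hx1

/-- Under PRDS, the conditional probability of an increasing event given that the `i`-th
coordinate is at most `t` is nondecreasing in `t`. -/
lemma PRDS.monotone_condProb {T : Set (Fin m)} (hPRDS : PRDS μ Q T) (hQ : Measurable Q)
    (hQu : InUnit Q) {D : Set (Fin m → ℝ)} (hD : MeasurableSet D) (hD' : IsUpperSet D)
    {i : Fin m} (hi : i ∈ T) :
    Monotone fun t : ℝ =>
      μ.real ({ω | Q ω ∈ D} ∩ {ω | Q ω i ≤ t}) / μ.real {ω | Q ω i ≤ t} := by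
  intro s t hst
  obtain ⟨g, hg, hgm, hgD⟩ := hPRDS D hD (fun x hx y hxy => hD' hxy hx) i hi
  have hQi : Measurable fun ω => Q ω i := (measurable_pi_apply i).comp hQ
  have hint : Integrable (fun ω => g (Q ω i)) μ :=
    Integrable.of_mem_Icc (g 0) (g 1) (hgm.comp hQi).aemeasurable
      (.of_forall fun ω => ⟨hg (hQu ω i).1, hg (hQu ω i).2⟩)
  have hs : MeasurableSet {ω | Q ω i ≤ s} := hQi measurableSet_Iic
  have hst' : MeasurableSet {ω | Q ω i ∈ Set.Ioc s t} := hQi measurableSet_Ioc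
  have hDm : MeasurableSet {ω | Q ω ∈ D} := hQ hD
  have hlow : μ.real ({ω | Q ω ∈ D} ∩ {ω | Q ω i ≤ s}) ≤ g s * μ.real {ω | Q ω i ≤ s} := by
    refine (hgD (Set.Iic s) measurableSet_Iic).trans_le ?_
    refine (setIntegral_mono_on hint.integrableOn (integrable_const (g s)) hs
      fun _ hω => hg hω).trans_eq ?_
    simp [mul_comm, measureReal_def]
  have hhigh : g s * μ.real {ω | Q ω i ∈ Set.Ioc s t} ≤
      μ.real ({ω | Q ω ∈ D} ∩ {ω | Q ω i ∈ Set.Ioc s t}) := by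
    refine le_of_le_of_eq ?_ (hgD (Set.Ioc s t) measurableSet_Ioc).symm
    refine le_of_eq_of_le ?_ (setIntegral_mono_on (integrable_const (g s)) hint.integrableOn hst'
      fun _ hω => hg (Set.mem_Ioc.1 hω).1.le)
    simp [mul_comm, measureReal_def]
  have hunion : {ω | Q ω i ≤ t} = {ω | Q ω i ≤ s} ∪ {ω | Q ω i ∈ Set.Ioc s t} := by
    ext ω
    simp only [Set.mem_ofPred_eq, Set.mem_union, Set.mem_Ioc]
    grind
  have hdisj : Disjoint {ω | Q ω i ≤ s} {ω | Q ω i ∈ Set.Ioc s t} :=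
    Set.disjoint_left.2 fun ω h h' => absurd h (not_le.2 h'.1)
  have htot : μ.real {ω | Q ω i ≤ t} =
      μ.real {ω | Q ω i ≤ s} + μ.real {ω | Q ω i ∈ Set.Ioc s t} := by
    rw [hunion, measureReal_union hdisj hst']
  have htotD : μ.real ({ω | Q ω ∈ D} ∩ {ω | Q ω i ≤ t}) =
      μ.real ({ω | Q ω ∈ D} ∩ {ω | Q ω i ≤ s}) +
        μ.real ({ω | Q ω ∈ D} ∩ {ω | Q ω i ∈ Set.Ioc s t}) := by
    rw [hunion, Set.inter_union_distrib_left,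
      measureReal_union (hdisj.mono Set.inter_subset_right Set.inter_subset_right)
        (hDm.inter hst')]
  rcases (measureReal_nonneg : 0 ≤ μ.real {ω | Q ω i ≤ s}).eq_or_lt with h0 | h0
  · simp only [← h0, div_zero]
    positivity
  · have h1 : 0 ≤ μ.real {ω | Q ω i ∈ Set.Ioc s t} := measureReal_nonneg
    simp only
    rw [div_le_div_iff₀ h0 (htot ▸ by positivity), htot, htotD]
    nlinarith [mul_le_mul_of_nonneg_right hlow h1, mul_le_mul_of_nonneg_right hhigh h0.le]

lemma integrable_bhTerm (hQ : Measurable Q) (A : Finset (Fin m)) (c : ℝ) (j : Fin m) :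
    Integrable (fun ω => bhTerm A c j (Q ω)) μ :=
  Integrable.of_mem_Icc 0 1 ((measurable_bhTerm A c j).comp hQ).aemeasurable
    (.of_forall fun _ => ⟨bhTerm_nonneg A c j _, bhTerm_le_one A c j _⟩)

/-- The Benjamini–Yekutieli bound on the contribution of a true null to the FDR under PRDS. -/
lemma integral_bhTerm_le {h : Fin m → Bool} (hQ : Measurable Q) (hQu : InUnit Q)
    (hsup : Superuniform μ Q h) (hPRDS : PRDS μ Q {j | h j = false}) (A : Finset (Fin m))
    {c : ℝ} (hc : 0 ≤ c) {j : Fin m} (hj : h j = false) :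
    ∫ ω, bhTerm A c j (Q ω) ∂μ ≤ c := by
  have hQj : Measurable fun ω => Q ω j := (measurable_pi_apply j).comp hQ
  have hN : Measurable fun ω => bhCount A c (Q ω) := (measurable_bhCount A c).comp hQ
  set E : ℕ → Set Ω := fun r => {ω | Q ω j ≤ (r : ℝ) * c} with hE
  set L : ℕ → Set Ω := fun r => {ω | Q ω ∈ {p | bhCount A c p ≤ r}} with hL
  have hEm : ∀ r, MeasurableSet (E r) := fun r => hQj measurableSet_Iic
  have hset : ∀ r : ℕ, MeasurableSet ({ω | bhCount A c (Q ω) = r + 1} ∩ E (r + 1)) :=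
    fun r => (hN (measurableSet_singleton (r + 1))).inter (hEm _)
  set φ : ℕ → ℝ := fun r => μ.real (L r ∩ E (r + 1)) / μ.real (E (r + 1)) with hφ
  have hmono : ∀ r k l : ℕ, k ≤ l →
      μ.real (L r ∩ E k) / μ.real (E k) ≤ μ.real (L r ∩ E l) / μ.real (E l) := fun r k l hkl =>
    hPRDS.monotone_condProb hQ hQu (D := {p | bhCount A c p ≤ r})
      (measurable_bhCount A c measurableSet_Iic)
      (fun p p' hp h => (antitone_bhCount A c hp).trans h) (i := j) hj
      (by gcongr : (k : ℝ) * c ≤ l * c)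
  have hterm : ∀ r : ℕ, μ.real ({ω | bhCount A c (Q ω) = r + 1} ∩ E (r + 1)) *
      ((r + 1 : ℕ) : ℝ)⁻¹ ≤ c * (φ (r + 1) - φ r) := by
    intro r
    have hdec : μ.real (L (r + 1) ∩ E (r + 1)) = μ.real (L r ∩ E (r + 1)) +
        μ.real ({ω | bhCount A c (Q ω) = r + 1} ∩ E (r + 1)) := by
      rw [← measureReal_union _ (hset r),
        ← Set.union_inter_distrib_right]
      · congr 2
        ext ω
        simp only [hL, Set.mem_ofPred_eq, Set.mem_union]
        omega
      · refine Set.disjoint_left.2 fun ω h h' => ?_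
        have h1 : bhCount A c (Q ω) ≤ r := h.1
        have h2 : bhCount A c (Q ω) = r + 1 := h'.1
        omega
    have hstep := hmono (r + 1) (r + 1) (r + 1 + 1) (Nat.le_succ _)
    rcases (measureReal_nonneg : 0 ≤ μ.real (E (r + 1))).eq_or_lt with h0 | h0
    · have hz : μ.real ({ω | bhCount A c (Q ω) = r + 1} ∩ E (r + 1)) = 0 :=
        le_antisymm ((measureReal_mono Set.inter_subset_right).trans_eq h0.symm) measureReal_nonneg
      have hφ0 : φ r = 0 := by simp [hφ, ← h0]
      have hφ1 : 0 ≤ φ (r + 1) := by simp only [hφ]; positivity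
      rw [hz, hφ0, zero_mul, sub_zero]
      positivity
    · have hsu : μ.real (E (r + 1)) ≤ ((r + 1 : ℕ) : ℝ) * c :=
        hsup.real_le hj (by positivity)
      have hnn : 0 ≤ μ.real ({ω | bhCount A c (Q ω) = r + 1} ∩ E (r + 1)) /
        μ.real (E (r + 1)) := by positivity
      have hinc : μ.real ({ω | bhCount A c (Q ω) = r + 1} ∩ E (r + 1)) / μ.real (E (r + 1)) ≤
          φ (r + 1) - φ r := by
        rw [hdec, add_div] at hstep
        simp only [hφ]
        linarith
      calc μ.real ({ω | bhCount A c (Q ω) = r + 1} ∩ E (r + 1)) * ((r + 1 : ℕ) : ℝ)⁻¹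
          = μ.real (E (r + 1)) * ((r + 1 : ℕ) : ℝ)⁻¹ *
            (μ.real ({ω | bhCount A c (Q ω) = r + 1} ∩ E (r + 1)) / μ.real (E (r + 1))) := by
            field_simp
        _ ≤ ((r + 1 : ℕ) : ℝ) * c * ((r + 1 : ℕ) : ℝ)⁻¹ * (φ (r + 1) - φ r) := by gcongr
        _ = c * (φ (r + 1) - φ r) := by field_simp
  have hint : ∫ ω, bhTerm A c j (Q ω) ∂μ = ∑ r ∈ range m,
      μ.real ({ω | bhCount A c (Q ω) = r + 1} ∩ E (r + 1)) * ((r + 1 : ℕ) : ℝ)⁻¹ := by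
    have hfun : (fun ω => bhTerm A c j (Q ω)) = fun ω => ∑ r ∈ range m,
        ({ω | bhCount A c (Q ω) = r + 1} ∩ E (r + 1)).indicator
          (fun _ => ((r + 1 : ℕ) : ℝ)⁻¹) ω := by
      funext ω
      rw [bhTerm_eq_sum]
      rfl
    rw [hfun, integral_finsetSum _ fun r _ => (integrable_const _).indicator (hset r)]
    exact sum_congr rfl fun r _ => by rw [integral_indicator_const _ (hset r), smul_eq_mul]
  have hφm : φ m ≤ 1 := div_le_one_of_le₀ (measureReal_mono Set.inter_subset_right)
    measureReal_nonneg
  have hφ0 : 0 ≤ φ 0 := by simp only [hφ]; positivity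
  calc ∫ ω, bhTerm A c j (Q ω) ∂μ ≤ ∑ r ∈ range m, c * (φ (r + 1) - φ r) :=
        hint.trans_le (sum_le_sum fun r _ => hterm r)
    _ = c * (φ m - φ 0) := by rw [← mul_sum, sum_range_sub]
    _ ≤ c * 1 := by gcongr; linarith
    _ = c := mul_one c

end Probability

/-- For a selection rule whose selected primary p-values are at most `a / m`, the rejection set
of Procedure 3.2 has the size of the Benjamini–Hochberg rejection set on the selected
hypotheses. -/
lemma card_rejSet_and_le {m : ℕ} {S : (Fin m → ℝ) → Finset (Fin m)} {a b : ℝ} (ha : 0 ≤ a)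
    (hb : 0 ≤ b) {p1 p2 : Fin m → ℝ} (hS : ∀ j ∈ S p1, p1 j ≤ a / m) :
    #(rejSet m S a (fun _ => b) p1 p2) = bhCount (S p1) (b / #(S p1)) p2 ∧
      ∀ j ∈ rejSet m S a (fun _ => b) p1 p2,
        p2 j ≤ bhCount (S p1) (b / #(S p1)) p2 * (b / #(S p1)) := by
  set f : ℕ → ℕ := fun r => #{j ∈ S p1 | p1 j ≤ r * a / m ∧ p2 j ≤ r * b / #(S p1)} with hf
  have hmono : Monotone f := by
    intro r s hrs
    refine card_le_card (monotone_filter_right _ fun j _ hj => ⟨hj.1.trans ?_, hj.2.trans ?_⟩) <;>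
      gcongr
  have hle : ∀ r, f r ≤ m := fun r => (card_le_univ _).trans_eq (Fintype.card_fin m)
  have hgr := isGreatest_fixed_findGreatest hmono hle
  have hfg : Nat.findGreatest (fun r => r ≤ f r) m = bhCount (S p1) (b / #(S p1)) p2 := by
    unfold bhCount
    congr 1
    funext r
    rcases r with _ | r
    · simp
    · simp only [hf, eq_iff_iff]
      congr! 2
      refine filter_congr fun j hj => ?_
      have h1 : p1 j ≤ ((r + 1 : ℕ) : ℝ) * a / m := by
        refine (hS j hj).trans ?_
        gcongr
        push_cast
        nlinarith [(Nat.cast_nonneg r : (0 : ℝ) ≤ r)]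
      rw [and_iff_right h1, mul_div_assoc]
  rw [hfg] at hgr
  have hrej : rejSet m S a (fun _ => b) p1 p2 = {j ∈ S p1 |
      p1 j ≤ (bhCount (S p1) (b / #(S p1)) p2 : ℕ) * a / m ∧
      p2 j ≤ (bhCount (S p1) (b / #(S p1)) p2 : ℕ) * b / #(S p1)} := by
    rw [← hgr.csSup_eq]
    rfl
  refine ⟨by rw [hrej]; exact hgr.1.2, fun j hj => ?_⟩
  rw [hrej, mem_filter] at hj
  rw [← mul_div_assoc]
  exact hj.2.2

lemma rejSet_subset {m : ℕ} (S : (Fin m → ℝ) → Finset (Fin m)) (a : ℝ) (b : ℕ → ℝ)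
    (p1 p2 : Fin m → ℝ) : rejSet m S a b p1 p2 ⊆ S p1 :=
  filter_subset _ _

lemma FDP_nonneg {m : ℕ} (I R : Finset (Fin m)) : 0 ≤ FDP I R := by
  unfold FDP
  positivity

lemma FDP_empty {m : ℕ} (I : Finset (Fin m)) : FDP I ∅ = 0 := by
  simp [FDP]

lemma FDP_union_le {m : ℕ} (I R R' : Finset (Fin m)) : FDP I (R ∪ R') ≤ FDP I R + FDP I R' := by
  unfold FDP
  calc (#((R ∪ R') ∩ I) : ℝ) / (max #(R ∪ R') 1 : ℕ)
      ≤ (#(R ∩ I) + #(R' ∩ I) : ℝ) / (max #(R ∪ R') 1 : ℕ) := by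
        gcongr
        rw [union_inter_distrib_right]
        exact_mod_cast card_union_le _ _
    _ ≤ _ := by
        rw [add_div]
        gcongr
        · exact subset_union_left
        · exact subset_union_right

/-- A bound for the false discovery proportion of Procedure 3.2 with the Bonferroni selection
rule, as a sum of contributions of single hypotheses. -/
noncomputable def fdpBound {m : ℕ} (h1 h2 : Fin m → Bool) (S : (Fin m → ℝ) → Finset (Fin m))
    (a b : ℝ) (p1 p2 : Fin m → ℝ) : ℝ :=
  ∑ j with h1 j = false, {p : Fin m → ℝ | p j ≤ a / m}.indicator (fun _ => 1) p1 +
    ∑ A : Finset (Fin m), {p | S p = A}.indicator (fun _ => 1) p1 *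
      ∑ j ∈ A with h2 j = false, bhTerm A (b / #A) j p2

lemma FDP_rejSet_le {m : ℕ} (h1 h2 : Fin m → Bool) {S : (Fin m → ℝ) → Finset (Fin m)} {a b : ℝ}
    (ha : 0 ≤ a) (hb : 0 ≤ b) {p1 p2 : Fin m → ℝ} (hS : ∀ j ∈ S p1, p1 j ≤ a / m) :
    FDP (nullNR h1 h2) (rejSet m S a (fun _ => b) p1 p2) ≤ fdpBound h1 h2 S a b p1 p2 := by
  obtain ⟨hcard, hle⟩ := card_rejSet_and_le ha hb hS (p2 := p2)
  have hsub := rejSet_subset S a (fun _ => b) p1 p2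
  set R := rejSet m S a (fun _ => b) p1 p2
  have hsum : ∑ A : Finset (Fin m), {p | S p = A}.indicator (fun _ => (1 : ℝ)) p1 *
      ∑ j ∈ A with h2 j = false, bhTerm A (b / #A) j p2 =
      ∑ j ∈ S p1 with h2 j = false, bhTerm (S p1) (b / #(S p1)) j p2 := by
    rw [sum_eq_single_of_mem (S p1) (mem_univ _)]
    · simp
    · intro A _ hA
      simp [hA.symm]
  have hI : R ∩ nullNR h1 h2 =
      {j ∈ R | h1 j = false} ∪ {j ∈ R | h2 j = false} := by
    ext j
    simp only [nullNR, mem_inter, mem_filter, mem_univ, true_and, mem_union]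
    tauto
  have hmax : ∀ j ∈ R, max #R 1 = #R := fun j hj => max_eq_left (card_pos.2 ⟨j, hj⟩)
  rw [fdpBound, hsum, FDP, hI]
  calc (#({j ∈ R | h1 j = false} ∪ {j ∈ R | h2 j = false}) : ℝ) / (max #R 1 : ℕ)
      ≤ (#{j ∈ R | h1 j = false} + #{j ∈ R | h2 j = false} : ℝ) / (max #R 1 : ℕ) := by
        gcongr
        exact_mod_cast card_union_le _ _
    _ = ∑ j ∈ R with h1 j = false, ((max #R 1 : ℕ) : ℝ)⁻¹ +
        ∑ j ∈ R with h2 j = false, ((max #R 1 : ℕ) : ℝ)⁻¹ := by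
        simp [div_eq_mul_inv, add_mul]
    _ ≤ ∑ j ∈ R with h1 j = false, {p : Fin m → ℝ | p j ≤ a / m}.indicator (fun _ => 1) p1 +
        ∑ j ∈ R with h2 j = false, bhTerm (S p1) (b / #(S p1)) j p2 := by
        refine add_le_add (sum_le_sum fun j hj => ?_) (sum_le_sum fun j hj => ?_)
        · have hp1 : p1 ∈ {p : Fin m → ℝ | p j ≤ a / m} := hS j (hsub (mem_filter.1 hj).1)
          rw [Set.indicator_of_mem hp1]
          exact Nat.cast_inv_le_one _
        · have hjR := (mem_filter.1 hj).1
          have hp2 : p2 ∈ {p : Fin m → ℝ | p j ≤ bhCount (S p1) (b / #(S p1)) p *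
            (b / #(S p1))} := hle j hjR
          rw [hmax j hjR, bhTerm, Set.indicator_of_mem hp2, hcard]
    _ ≤ _ := by
        refine add_le_add (sum_le_sum_of_subset_of_nonneg ?_ fun j _ _ =>
          Set.indicator_nonneg (fun _ _ => zero_le_one) _) (sum_le_sum_of_subset_of_nonneg
            (filter_subset_filter _ hsub) fun j _ _ => bhTerm_nonneg _ _ _ _)
        exact filter_subset_filter _ (subset_univ _)

lemma integrable_fdpBound_and_integral_le {Ω : Type*} [MeasurableSpace Ω] {μ : Measure Ω}
    [IsProbabilityMeasure μ] {m : ℕ} {P1 P2 : Ω → Fin m → ℝ} (hP1 : Measurable P1)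
    (hP2 : Measurable P2) (hP2u : InUnit P2) {h1 h2 : Fin m → Bool}
    (hsup1 : Superuniform μ P1 h1) (hsup2 : Superuniform μ P2 h2) (hIndep : IndepFun P1 P2 μ)
    (hPRDS2 : PRDS μ P2 {j | h2 j = false}) {S : (Fin m → ℝ) → Finset (Fin m)}
    (hS : MeasRule m S) {a b : ℝ} (ha : 0 ≤ a) (hb : 0 ≤ b) :
    Integrable (fun ω => fdpBound h1 h2 S a b (P1 ω) (P2 ω)) μ ∧
      ∫ ω, fdpBound h1 h2 S a b (P1 ω) (P2 ω) ∂μ ≤ a + b := by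
  have hprim : ∀ j, MeasurableSet {ω | P1 ω j ≤ a / m} := fun j =>
    ((measurable_pi_apply j).comp hP1) measurableSet_Iic
  have hsel : ∀ A, MeasurableSet {ω | S (P1 ω) = A} := fun A => hP1 (hS A)
  have hint1 : ∀ j, Integrable
      (fun ω => {p : Fin m → ℝ | p j ≤ a / m}.indicator (fun _ => (1 : ℝ)) (P1 ω)) μ :=
    fun j => (integrable_const (1 : ℝ)).indicator (hprim j)
  have hselInt : ∀ A, Integrable
      (fun ω => {p | S p = A}.indicator (fun _ => (1 : ℝ)) (P1 ω)) μ :=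
    fun A => (integrable_const (1 : ℝ)).indicator (hsel A)
  have hselMeas : ∀ A, Measurable ({p | S p = A}.indicator fun _ => (1 : ℝ)) :=
    fun A => measurable_const.indicator (hS A)
  have hfolMeas : ∀ A : Finset (Fin m),
      Measurable fun p => ∑ j ∈ A with h2 j = false, bhTerm A (b / #A) j p :=
    fun A => Finset.measurable_sum _ fun j _ => measurable_bhTerm A _ j
  have hfolInt : ∀ A : Finset (Fin m), Integrable
      (fun ω => ∑ j ∈ A with h2 j = false, bhTerm A (b / #A) j (P2 ω)) μ :=
    fun A => integrable_finsetSum _ fun j _ => integrable_bhTerm hP2 A _ j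
  have hind : ∀ A : Finset (Fin m), IndepFun
      (fun ω => {p | S p = A}.indicator (fun _ => (1 : ℝ)) (P1 ω))
      (fun ω => ∑ j ∈ A with h2 j = false, bhTerm A (b / #A) j (P2 ω)) μ :=
    fun A => hIndep.comp (hselMeas A) (hfolMeas A)
  have hint2 : ∀ A : Finset (Fin m), Integrable
      (fun ω => {p | S p = A}.indicator (fun _ => (1 : ℝ)) (P1 ω) *
        ∑ j ∈ A with h2 j = false, bhTerm A (b / #A) j (P2 ω)) μ :=
    fun A => (hind A).integrable_mul (hselInt A) (hfolInt A)
  refine ⟨(integrable_finsetSum _ fun j _ => hint1 j).add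
    (integrable_finsetSum _ fun A _ => hint2 A), ?_⟩
  unfold fdpBound
  rw [integral_add (integrable_finsetSum _ fun j _ => hint1 j)
    (integrable_finsetSum _ fun A _ => hint2 A), integral_finsetSum _ fun j _ => hint1 j,
    integral_finsetSum _ fun A _ => hint2 A]
  refine add_le_add ?_ ?_
  · calc ∑ j with h1 j = false,
          ∫ ω, {p : Fin m → ℝ | p j ≤ a / m}.indicator (fun _ => (1 : ℝ)) (P1 ω) ∂μ
        ≤ ∑ j with h1 j = false, a / m := by
          refine sum_le_sum fun j hj => ?_
          refine (integral_indicator_const (1 : ℝ) (hprim j)).trans_le ?_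
          rw [smul_eq_mul, mul_one]
          exact hsup1.real_le (mem_filter.1 hj).2 (by positivity)
      _ ≤ ∑ j : Fin m, a / m :=
          sum_le_sum_of_subset_of_nonneg (subset_univ _) fun _ _ _ => by positivity
      _ ≤ a := by
          rw [sum_const, card_univ, Fintype.card_fin, nsmul_eq_mul]
          exact natCast_mul_div_le _ ha
  · have hfol : ∀ A : Finset (Fin m),
        ∫ ω, ∑ j ∈ A with h2 j = false, bhTerm A (b / #A) j (P2 ω) ∂μ ≤ b := by
      intro A
      rw [integral_finsetSum _ fun j _ => integrable_bhTerm hP2 A _ j]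
      calc _ ≤ ∑ j ∈ A with h2 j = false, b / #A :=
            sum_le_sum fun j hj => integral_bhTerm_le hP2 hP2u hsup2 hPRDS2 A (by positivity)
              (mem_filter.1 hj).2
        _ ≤ ∑ j ∈ A, b / #A :=
            sum_le_sum_of_subset_of_nonneg (filter_subset _ _) fun _ _ _ => by positivity
        _ ≤ b := by
            rw [sum_const, nsmul_eq_mul]
            exact natCast_mul_div_le _ hb
    have hselSum : ∑ A : Finset (Fin m),
        ∫ ω, {p | S p = A}.indicator (fun _ => (1 : ℝ)) (P1 ω) ∂μ = 1 := by
      rw [← integral_finsetSum _ fun A _ => hselInt A]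
      simp [Set.indicator_apply]
    calc _ = ∑ A : Finset (Fin m), (∫ ω, {p | S p = A}.indicator (fun _ => (1 : ℝ)) (P1 ω) ∂μ) *
          ∫ ω, ∑ j ∈ A with h2 j = false, bhTerm A (b / #A) j (P2 ω) ∂μ :=
          sum_congr rfl fun A _ => (hind A).integral_fun_mul_eq_mul_integral
            (hselInt A).aestronglyMeasurable (hfolInt A).aestronglyMeasurable
      _ ≤ ∑ A : Finset (Fin m),
          (∫ ω, {p | S p = A}.indicator (fun _ => (1 : ℝ)) (P1 ω) ∂μ) * b :=
          sum_le_sum fun A _ => mul_le_mul_of_nonneg_left (hfol A)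
            (integral_nonneg fun ω => Set.indicator_nonneg (fun _ _ => zero_le_one) _)
      _ = b := by rw [← sum_mul, hselSum, one_mul]

lemma measRule_bonferroni (m : ℕ) (x : ℝ) :
    MeasRule m fun p => Finset.univ.filter fun j => p j ≤ x := by
  intro A
  have hset : {p : Fin m → ℝ | (Finset.univ.filter fun j => p j ≤ x) = A} =
      ⋂ j, {p | p j ≤ x ↔ j ∈ A} := by
    ext p
    simp [Finset.ext_iff]
  rw [hset]
  refine MeasurableSet.iInter fun j => ?_
  have hj : MeasurableSet {p : Fin m → ℝ | p j ≤ x} := measurable_pi_apply j measurableSet_Iic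
  by_cases hA : j ∈ A
  · simpa only [hA, iff_true] using hj
  · simp only [hA, iff_false]
    exact hj.compl

lemma nullNR_comm {m : ℕ} (h1 h2 : Fin m → Bool) : nullNR h1 h2 = nullNR h2 h1 := by
  simp only [nullNR, or_comm]

lemma FDP_ite_empty_le {m : ℕ} (I R : Finset (Fin m)) (c : Prop) [Decidable c] :
    FDP I (if c then ∅ else R) ≤ FDP I R := by
  split_ifs
  · exact FDP_empty I ▸ FDP_nonneg I R
  · exact le_rfl

/-- Theorem S3.3, item 1: with the two studies independent and each study's
p-value vector PRDS on its true nulls, Procedure 4.1 with parameters `(w₁, q₁, q)` and the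
Bonferroni selection rules `S₁₂(p) = {j : pⱼ ≤ w₁q₁/m}`, `S₂₁(p) = {j : pⱼ ≤ (1-w₁)q₁/m}`
controls the FDR at level `q` for the no-replicability nulls. -/
theorem theorem_S33_item1 {Ω : Type*} [MeasurableSpace Ω]
    (μ : Measure Ω) [IsProbabilityMeasure μ]
    (m : ℕ) (hm : 1 ≤ m)
    (P1 P2 : Ω → Fin m → ℝ) (hP1 : Measurable P1) (hP2 : Measurable P2)
    (hP1u : InUnit P1) (hP2u : InUnit P2)
    (h1 h2 : Fin m → Bool)
    (hsup1 : Superuniform μ P1 h1) (hsup2 : Superuniform μ P2 h2)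
    (hIndep : IndepFun P1 P2 μ)
    (hPRDS1 : PRDS μ P1 {j | h1 j = false})
    (hPRDS2 : PRDS μ P2 {j | h2 j = false})
    (w1 : ℝ) (hw0 : 0 ≤ w1) (hw1 : w1 ≤ 1)
    (q1 q : ℝ) (hq1 : 0 < q1) (hq1q : q1 < q) (hq : q < 1) :
    ∫ ω, FDP (nullNR h1 h2)
        ((if w1 = 0 then ∅ else
            rejSet m (fun p => Finset.univ.filter fun j => p j ≤ w1 * q1 / m)
              (w1 * q1) (fun _ => w1 * q - w1 * q1) (P1 ω) (P2 ω))
          ∪ (if w1 = 1 then ∅ else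
            rejSet m (fun p => Finset.univ.filter fun j => p j ≤ (1 - w1) * q1 / m)
              ((1 - w1) * q1) (fun _ => (1 - w1) * q - (1 - w1) * q1)
              (P2 ω) (P1 ω))) ∂μ ≤ q := by
  have hqq : 0 < q - q1 := sub_pos.2 hq1q
  have hv0 : 0 ≤ 1 - w1 := sub_nonneg.2 hw1
  have ha : 0 ≤ w1 * q1 := by positivity
  have hb : 0 ≤ w1 * q - w1 * q1 := by rw [← mul_sub]; positivity
  have ha' : 0 ≤ (1 - w1) * q1 := by positivity
  have hb' : 0 ≤ (1 - w1) * q - (1 - w1) * q1 := by rw [← mul_sub]; positivity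
  obtain ⟨hi, hle⟩ := integrable_fdpBound_and_integral_le hP1 hP2 hP2u hsup1 hsup2 hIndep hPRDS2
    (measRule_bonferroni m (w1 * q1 / m)) ha hb
  obtain ⟨hi', hle'⟩ := integrable_fdpBound_and_integral_le hP2 hP1 hP1u hsup2 hsup1 hIndep.symm
    hPRDS1 (measRule_bonferroni m ((1 - w1) * q1 / m)) ha' hb'
  refine (integral_mono_of_nonneg (.of_forall fun ω => FDP_nonneg _ _) (hi.add hi')
    (.of_forall fun ω => (FDP_union_le _ _ _).trans (add_le_add
      ((FDP_ite_empty_le _ _ _).trans (FDP_rejSet_le h1 h2 ha hb fun j hj => (mem_filter.1 hj).2))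
      ((FDP_ite_empty_le _ _ _).trans ?_)))).trans ?_
  · rw [nullNR_comm h1 h2]
    exact FDP_rejSet_le h2 h1 ha' hb' fun j hj => (mem_filter.1 hj).2
  · rw [integral_add' hi hi']
    linarith

end Replicability
end

section
/- (Telescoping bound for superuniform p-values, proved in the proof of Theorem 3.3 item 1) Let P be a random variable with values in [0,1] such that Pr(P ≤ x) ≤ x for all x ≥ 0. Then for every real c > 0 and every integer m ≥ 1, ∑_{l=1}^{m} (1/l) · (Pr(P ≤ l c) − Pr(P ≤ (l−1) c)) ≤ c · ∑_{l=1}^{m} 1/l. In particular, with c = q_1/(m ∑_{s=1}^m 1/s), the left-hand side is at most q_1/m. -/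
open MeasureTheory ProbabilityTheory Finset

namespace Replicability

/-- Summation by parts for a function below the line `x ↦ c * x` on the naturals, stated with the
nonpositive remainder that makes the induction go through. -/
lemma sum_inv_mul_sub_le (F : ℝ → ℝ) (c : ℝ) (h0 : 0 ≤ F 0)
    (hF : ∀ l : ℕ, F l ≤ l * c) (m : ℕ) (hm : 1 ≤ m) :
    ∑ l ∈ Finset.Icc 1 m, (1 / (l : ℝ)) * (F l - F ((l : ℝ) - 1))
      ≤ c * ∑ l ∈ Finset.Icc 1 m, (1 / (l : ℝ)) + (F m - m * c) / m := by
  induction m, hm using Nat.le_induction with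
  | base => simpa using h0
  | succ n hn ih =>
    rw [Finset.sum_Icc_succ_top (by omega), Finset.sum_Icc_succ_top (by omega)]
    have hn0 : (0 : ℝ) < n := by exact_mod_cast hn
    have hdiv : (F n - n * c) / n ≤ (F n - n * c) / (n + 1) := by
      rw [div_le_div_iff₀ hn0 (by positivity)]
      nlinarith [hF n]
    push_cast
    rw [add_sub_cancel_right]
    have hsplit : 1 / ((n : ℝ) + 1) * (F (n + 1) - F n) + (F n - n * c) / (n + 1)
        = c * (1 / ((n : ℝ) + 1)) + (F (n + 1) - (n + 1) * c) / (n + 1) := by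
      ring
    linarith

lemma Hsum_eq_sum_Icc (m : ℕ) : Hsum m = ∑ l ∈ Finset.Icc 1 m, (1 / (l : ℝ)) := by
  rw [Hsum, Finset.range_eq_Ico, ← Finset.Ico_add_one_right_eq_Icc]
  simpa using Finset.sum_Ico_add' (fun l : ℕ => (1 : ℝ) / l) 0 m 1

/-- telescoping bound for superuniform p-values: if `Pr(P ≤ x) ≤ x` for all
`x ≥ 0`, then for every `c > 0` and `m ≥ 1`,
`∑_{l=1}^m (1/l)(Pr(P ≤ lc) - Pr(P ≤ (l-1)c)) ≤ c ∑_{l=1}^m 1/l`; in particular, with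
`c = q₁/(m ∑_{s=1}^m 1/s)` the left-hand side is at most `q₁/m`. -/
theorem telescoping_superuniform_bound {Ω : Type*} [MeasurableSpace Ω]
    (μ : Measure Ω) [IsProbabilityMeasure μ]
    (P : Ω → ℝ) (hP : Measurable P) (hPu : ∀ ω, P ω ∈ Set.Icc (0 : ℝ) 1)
    (hsup : ∀ x : ℝ, 0 ≤ x → μ {ω | P ω ≤ x} ≤ ENNReal.ofReal x)
    (q1 : ℝ) (hq1 : 0 < q1) (hq1' : q1 < 1)
    (c : ℝ) (hc : 0 < c) (m : ℕ) (hm : 1 ≤ m) :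
    (∑ l ∈ Finset.Icc 1 m, (1 / (l : ℝ)) *
        ((μ {ω | P ω ≤ (l : ℝ) * c}).toReal - (μ {ω | P ω ≤ ((l : ℝ) - 1) * c}).toReal))
      ≤ c * ∑ l ∈ Finset.Icc 1 m, (1 / (l : ℝ))
    ∧ (c = q1 / (m * Hsum m) →
        (∑ l ∈ Finset.Icc 1 m, (1 / (l : ℝ)) *
          ((μ {ω | P ω ≤ (l : ℝ) * c}).toReal
            - (μ {ω | P ω ≤ ((l : ℝ) - 1) * c}).toReal))
          ≤ q1 / m) := by
  have hm0 : (0 : ℝ) < m := by exact_mod_cast hm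
  have hF : ∀ l : ℕ, (μ {ω | P ω ≤ (l : ℝ) * c}).toReal ≤ l * c := fun l =>
    ENNReal.toReal_le_of_le_ofReal (by positivity) (hsup _ (by positivity))
  have hbound := sum_inv_mul_sub_le (fun x => (μ {ω | P ω ≤ x * c}).toReal) c
    ENNReal.toReal_nonneg hF m hm
  have hrem : ((μ {ω | P ω ≤ (m : ℝ) * c}).toReal - m * c) / m ≤ 0 :=
    div_nonpos_of_nonpos_of_nonneg (sub_nonpos.2 (hF m)) hm0.le
  have hmain := hbound.trans (add_le_of_nonpos_right hrem)
  refine ⟨hmain, fun hcq => hmain.trans_eq ?_⟩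
  have hH : Hsum m ≠ 0 := by
    intro h
    simp [h] at hcq
    exact hc.ne' hcq
  rw [← Hsum_eq_sum_Icc, hcq]
  field_simp

end Replicability
end
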